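/- Let X be a continuum of type λ, that is, X is irreducible and every indecomposable subcontinuum of X has empty interior. Then NB(F₁(X)) has exactly three elements. -/

import Mathlib

open Set Filter Metric

/-- `B` does not block `x`: the union of all subcontinua of `X` containing `x`
and contained in the complement of `B` is dense. -/
def NotBlocks {X : Type*} [TopologicalSpace X] (B : Set X) (x : X) : Prop :=
  Dense (⋃₀ {K : Set X | IsCompact K ∧ IsConnected K ∧ x ∈ K ∧ K ⊆ Bᶜ})

/-- The hyperspace `NB(F₁(X))`: nonempty proper closed subsets that do not block
any point of their complement. -/
def NB (X : Type*) [TopologicalSpace X] : Set (Set X) :=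
  {B | B.Nonempty ∧ B ≠ univ ∧ IsClosed B ∧ ∀ x ∉ B, NotBlocks B x}

/-- The hyperspace `NB*(F₁(X))`: nonempty proper closed subsets that do not block
at least one point of their complement. -/
def NBstar (X : Type*) [TopologicalSpace X] : Set (Set X) :=
  {B | B.Nonempty ∧ B ≠ univ ∧ IsClosed B ∧ ∃ x ∉ B, NotBlocks B x}

/-- `F₁(X)`: the one-point subsets of `X`. -/
def F1 (X : Type*) [TopologicalSpace X] : Set (Set X) :=
  {A | ∃ x : X, A = {x}}

/-- `NWC(X)`: nonempty proper closed subsets with empty interior that are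
non-weak cut sets. -/
def NWC (X : Type*) [TopologicalSpace X] : Set (Set X) :=
  {A | A.Nonempty ∧ A ≠ univ ∧ IsClosed A ∧ interior A = ∅ ∧
    ∀ x ∉ A, ∀ y ∉ A, ∃ K : Set X, IsCompact K ∧ IsConnected K ∧ K ⊆ Aᶜ ∧ x ∈ K ∧ y ∈ K}

/-- A shore set: a nonempty proper closed subset `A` such that some sequence of
subcontinua contained in the complement of `A` converges to `X` in the Hausdorff metric. -/
def ShoreSet {X : Type*} [MetricSpace X] (A : Set X) : Prop :=
  A.Nonempty ∧ A ≠ univ ∧ IsClosed A ∧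
    ∃ C : ℕ → Set X, (∀ n, IsCompact (C n) ∧ IsConnected (C n) ∧ C n ⊆ Aᶜ) ∧
      Tendsto (fun n => hausdorffDist (C n) (univ : Set X)) atTop (nhds 0)

/-- `S(X)`: the collection of all shore sets of `X`. -/
def Shore (X : Type*) [MetricSpace X] : Set (Set X) :=
  {A | ShoreSet A}

/-- The composant of a point `z`: the union of all proper subcontinua containing `z`. -/
def composant {X : Type*} [TopologicalSpace X] (z : X) : Set X :=
  ⋃₀ {L : Set X | IsCompact L ∧ IsConnected L ∧ L ≠ univ ∧ z ∈ L}

/-- `X` is irreducible between `p` and `q`: no proper subcontinuum contains both. -/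
def IrrBetween {X : Type*} [TopologicalSpace X] (p q : X) : Prop :=
  ∀ L : Set X, IsCompact L → IsConnected L → p ∈ L → q ∈ L → L = univ

/-- A subcontinuum `K` is decomposable if it is the union of two proper subcontinua. -/
def DecomposableSet {X : Type*} [TopologicalSpace X] (K : Set X) : Prop :=
  ∃ A B : Set X, IsCompact A ∧ IsConnected A ∧ A ⊆ K ∧ A ≠ K ∧
    IsCompact B ∧ IsConnected B ∧ B ⊆ K ∧ B ≠ K ∧ A ∪ B = K

/-- `s(x)` relative to the point `p`: the union of all subcontinua containing `x`
and contained in `X \ {p}`. -/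
def sComp {X : Type*} [TopologicalSpace X] (p x : X) : Set X :=
  ⋃₀ {K : Set X | IsCompact K ∧ IsConnected K ∧ x ∈ K ∧ K ⊆ ({p} : Set X)ᶜ}

section Irreducible

variable {X : Type*} [TopologicalSpace X]

/-- If a connected set is the union of a connected set `C` and two disjoint open sets, then the
union of `C` with either of these open sets is connected. -/
lemma IsPreconnected.union_open_part {C U V : Set X} (hN : IsPreconnected (C ∪ U ∪ V))
    (hC : IsPreconnected C) (hU : IsOpen U) (hV : IsOpen V) (hUV : U ∩ V = ∅) :
    IsPreconnected (C ∪ U) := by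
  have key : ∀ P Q : Set X, IsOpen P → IsOpen Q → C ∪ U ⊆ P ∪ Q → (C ∪ U) ∩ (P ∩ Q) = ∅ →
      C ⊆ P → C ∪ U ⊆ P ∨ C ∪ U ⊆ Q := by
    intro P Q hP hQ hsub hdis hCP
    have h := isPreconnected_iff_subset_of_disjoint.1 hN (P ∪ V) (Q ∩ U) (hP.union hV)
      (hQ.inter hU)
      (by
        rintro x ((hx | hx) | hx)
        · exact Or.inl (Or.inl (hCP hx))
        · rcases hsub (Or.inr hx) with h | h
          · exact Or.inl (Or.inl h)
          · exact Or.inr ⟨h, hx⟩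
        · exact Or.inl (Or.inr hx))
      (by
        rw [eq_empty_iff_forall_notMem] at *
        rintro x ⟨-, hx | hx, hQx, hUx⟩
        · exact hdis x ⟨Or.inr hUx, hx, hQx⟩
        · exact hUV x ⟨hUx, hx⟩)
    rcases h with h | h
    · refine Or.inl (union_subset hCP fun x hx => ?_)
      rcases h (Or.inl (Or.inr hx)) with h' | h'
      · exact h'
      · exact absurd (show x ∈ U ∩ V from ⟨hx, h'⟩) (by simp [hUV])
    · exact Or.inr fun x hx => (h (Or.inl hx)).1
  rw [isPreconnected_iff_subset_of_disjoint]
  intro P Q hP hQ hsub hdis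
  rcases isPreconnected_iff_subset_of_disjoint.1 hC P Q hP hQ
    (subset_union_left.trans hsub)
    (subset_empty_iff.1 (hdis ▸ inter_subset_inter_left _ subset_union_left)) with h | h
  · exact key P Q hP hQ hsub hdis h
  · exact (key Q P hQ hP (by rwa [union_comm Q P]) (by rwa [inter_comm Q P]) h).symm

lemma IrrBetween.symm {p q : X} (h : IrrBetween p q) : IrrBetween q p :=
  fun L hc hL hq hp => h L hc hL hp hq

variable {p q : X}

lemma IrrBetween.notMem_of_ne_univ (h : IrrBetween p q) {N : Set X} (hc : IsCompact N)
    (hN : IsConnected N) (hq : q ∈ N) (hne : N ≠ univ) : p ∉ N :=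
  fun hp => hne (h N hc hN hp hq)

/-- The union of two proper subcontinua containing `q` is a proper subcontinuum. -/
lemma IrrBetween.union_ne_univ (h : IrrBetween p q) {M N : Set X}
    (hMc : IsCompact M) (hM : IsConnected M) (hqM : q ∈ M) (hMne : M ≠ univ)
    (hNc : IsCompact N) (hN : IsConnected N) (hqN : q ∈ N) (hNne : N ≠ univ) :
    M ∪ N ≠ univ := fun he =>
  (he ▸ mem_univ p : p ∈ M ∪ N).elim (h.notMem_of_ne_univ hMc hM hqM hMne)
    (h.notMem_of_ne_univ hNc hN hqN hNne)

/-- The intersection of the closures of the complements of all proper subcontinua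
containing `q`. -/
def endLayer (q : X) : Set X :=
  {x | ∀ N : Set X, IsCompact N → IsConnected N → q ∈ N → N ≠ univ → x ∈ closure Nᶜ}

lemma isClosed_endLayer (q : X) : IsClosed (endLayer q) := by
  have : endLayer q = ⋂ (N : Set X) (_ : IsCompact N) (_ : IsConnected N) (_ : q ∈ N)
      (_ : N ≠ univ), closure Nᶜ := by
    ext x; simp [endLayer]
  rw [this]
  exact isClosed_iInter fun _ => isClosed_iInter fun _ => isClosed_iInter fun _ =>
    isClosed_iInter fun _ => isClosed_iInter fun _ => isClosed_closure

/-- Off the end layer, points lie in the interior of a proper subcontinuum containing `q`. -/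
lemma exists_mem_interior_of_notMem_endLayer {x : X} (hx : x ∉ endLayer q) :
    ∃ N : Set X, IsCompact N ∧ IsConnected N ∧ q ∈ N ∧ N ≠ univ ∧ x ∈ interior N := by
  simp only [endLayer, mem_ofPred_eq, not_forall] at hx
  obtain ⟨N, hc, hN, hq, hne, hx⟩ := hx
  exact ⟨N, hc, hN, hq, hne, by rwa [closure_compl, notMem_compl_iff] at hx⟩

lemma IrrBetween.exists_pair_mem_interior (h : IrrBetween p q) {x y : X}
    (hx : x ∉ endLayer q) (hy : y ∉ endLayer q) :
    ∃ N : Set X, IsCompact N ∧ IsConnected N ∧ q ∈ N ∧ N ≠ univ ∧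
      x ∈ interior N ∧ y ∈ interior N := by
  obtain ⟨M, hMc, hM, hqM, hMne, hxM⟩ := exists_mem_interior_of_notMem_endLayer hx
  obtain ⟨N, hNc, hN, hqN, hNne, hyN⟩ := exists_mem_interior_of_notMem_endLayer hy
  exact ⟨M ∪ N, hMc.union hNc, hM.union ⟨q, hqM, hqN⟩ hN, Or.inl hqM,
    h.union_ne_univ hMc hM hqM hMne hNc hN hqN hNne,
    interior_mono subset_union_left hxM, interior_mono subset_union_right hyN⟩

lemma IrrBetween.mem_endLayer (h : IrrBetween p q) : p ∈ endLayer q :=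
  fun _ hc hN hq hne => subset_closure (h.notMem_of_ne_univ hc hN hq hne)

variable [CompactSpace X]

/-- In a continuum irreducible between `p` and `q`, the complement of a subcontinuum
containing `p` is connected. -/
lemma IrrBetween.isPreconnected_compl [PreconnectedSpace X] (h : IrrBetween p q) {K : Set X}
    (hKc : IsClosed K) (hK : IsPreconnected K) (hp : p ∈ K) : IsPreconnected Kᶜ := by
  rw [isPreconnected_iff_subset_of_disjoint]
  intro U V hU hV hsub hdis
  have key : ∀ U V : Set X, IsOpen U → IsOpen V → Kᶜ ⊆ U ∪ V → Kᶜ ∩ (U ∩ V) = ∅ →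
      q ∈ K ∪ U → Kᶜ ⊆ U := by
    intro U V hU hV hsub hdis hq
    rw [eq_empty_iff_forall_notMem] at hdis
    have hcov : K ∪ (U ∩ Kᶜ) ∪ (V ∩ Kᶜ) = univ := by
      ext x
      have := @hsub x
      simp only [mem_union, mem_inter_iff, mem_compl_iff, mem_univ, iff_true] at *
      tauto
    have hpre : IsPreconnected (K ∪ (U ∩ Kᶜ)) :=
      IsPreconnected.union_open_part (by rw [hcov]; exact isPreconnected_univ) hK
        (hU.inter hKc.isOpen_compl) (hV.inter hKc.isOpen_compl)
        (eq_empty_iff_forall_notMem.2 fun x hx => hdis x ⟨hx.1.2, hx.1.1, hx.2.1⟩)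
    have hcl : IsClosed (K ∪ (U ∩ Kᶜ)) := by
      have : K ∪ (U ∩ Kᶜ) = (V ∩ Kᶜ)ᶜ := by
        ext x
        have h1 := @hsub x
        have h2 := hdis x
        simp only [mem_union, mem_inter_iff, mem_compl_iff] at *
        tauto
      rw [this]
      exact (hV.inter hKc.isOpen_compl).isClosed_compl
    have huniv := h _ hcl.isCompact ⟨⟨p, Or.inl hp⟩, hpre⟩ (Or.inl hp)
      (by
        by_cases hqK : q ∈ K
        · exact Or.inl hqK
        · exact Or.inr ⟨hq.resolve_left hqK, hqK⟩)
    intro x hx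
    have : x ∈ K ∪ (U ∩ Kᶜ) := huniv ▸ mem_univ x
    exact (this.resolve_left hx).1
  by_cases hq : q ∈ K ∪ U
  · exact Or.inl (key U V hU hV hsub hdis hq)
  · refine Or.inr (key V U hV hU (by rwa [union_comm V U]) (by rwa [inter_comm V U]) ?_)
    have := @hsub q
    simp only [mem_union, mem_compl_iff] at *
    tauto

/-- In a continuum irreducible between `p` and `q`, removing disjoint subcontinua
containing `p` and `q` respectively leaves a connected set. -/
lemma IrrBetween.isPreconnected_compl_union [PreconnectedSpace X] (h : IrrBetween p q)
    {K L : Set X} (hKc : IsClosed K) (hK : IsPreconnected K) (hp : p ∈ K)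
    (hLc : IsClosed L) (hL : IsPreconnected L) (hq : q ∈ L) (hKL : Disjoint K L) :
    IsPreconnected (K ∪ L)ᶜ := by
  rw [isPreconnected_iff_subset_of_disjoint]
  intro U V hU hV hsub hdis
  rw [eq_empty_iff_forall_notMem] at hdis
  have hO : IsOpen (K ∪ L)ᶜ := (hKc.union hLc).isOpen_compl
  set U' := U ∩ (K ∪ L)ᶜ with hU'
  set V' := V ∩ (K ∪ L)ᶜ with hV'
  have hUV : U' ∩ V' = ∅ :=
    eq_empty_iff_forall_notMem.2 fun x hx => hdis x ⟨hx.1.2, hx.1.1, hx.2.1⟩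
  rcases U'.eq_empty_or_nonempty with hE | ⟨u, hu⟩
  · refine Or.inr fun x hx => (hsub hx).resolve_left fun hxU => ?_
    exact absurd (show x ∈ U' from ⟨hxU, hx⟩) (by simp [hE])
  have hKL' : ∀ x, x ∈ K → x ∉ L := fun x hx hx' => disjoint_left.1 hKL hx hx'
  have h1 : IsPreconnected (K ∪ U') := by
    refine IsPreconnected.union_open_part (V := V') ?_ hK (hU.inter hO) (hV.inter hO) hUV
    convert h.symm.isPreconnected_compl hLc hL hq using 1
    ext x
    have h1 := @hsub x
    have h2 := hKL' x
    simp only [hU', hV', mem_union, mem_inter_iff, mem_compl_iff] at *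
    tauto
  have h2 : IsPreconnected (L ∪ U') := by
    refine IsPreconnected.union_open_part (V := V') ?_ hL (hU.inter hO) (hV.inter hO) hUV
    convert h.isPreconnected_compl hKc hK hp using 1
    ext x
    have h1 := @hsub x
    have h2 := hKL' x
    simp only [hU', hV', mem_union, mem_inter_iff, mem_compl_iff] at *
    tauto
  have h3 : IsPreconnected ((K ∪ U') ∪ (L ∪ U')) := h1.union u (Or.inr hu) (Or.inr hu) h2
  have hcl : IsClosed ((K ∪ U') ∪ (L ∪ U')) := by
    have : (K ∪ U') ∪ (L ∪ U') = V'ᶜ := by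
      ext x
      have h1 := @hsub x
      have h2 := hdis x
      simp only [hU', hV', mem_union, mem_inter_iff, mem_compl_iff] at *
      tauto
    rw [this]
    exact (hV.inter hO).isClosed_compl
  have huniv := h _ hcl.isCompact ⟨⟨u, Or.inl (Or.inr hu)⟩, h3⟩ (Or.inl (Or.inl hp))
    (Or.inr (Or.inl hq))
  refine Or.inl fun x hx => ?_
  have h4 : x ∈ (K ∪ U') ∪ (L ∪ U') := huniv ▸ mem_univ x
  simp only [hU', mem_union, mem_inter_iff, mem_compl_iff] at h4 hx
  tauto

/-- The closure of the complement of a proper subcontinuum containing `q` is a continuum. -/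
lemma IrrBetween.isConnected_closure_compl [T2Space X] [PreconnectedSpace X]
    (h : IrrBetween p q) {N : Set X} (hc : IsCompact N)
    (hN : IsConnected N) (hq : q ∈ N) (hne : N ≠ univ) :
    IsConnected (closure Nᶜ) :=
  IsConnected.closure ⟨⟨p, h.notMem_of_ne_univ hc hN hq hne⟩,
    h.symm.isPreconnected_compl hc.isClosed hN.isPreconnected hq⟩

variable [T2Space X]

lemma isConnected_iInter_of_directed {ι : Type*} [Nonempty ι] {S : ι → Set X}
    (hd : Directed (· ⊇ ·) S) (hc : ∀ i, IsClosed (S i)) (hS : ∀ i, IsConnected (S i)) :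
    IsConnected (⋂ i, S i) := by
  refine ⟨IsCompact.nonempty_iInter_of_directed_nonempty_isCompact_isClosed S hd
    (fun i => (hS i).nonempty) (fun i => (hc i).isCompact) hc, ?_⟩
  rw [isPreconnected_iff_subset_of_fully_disjoint_closed (isClosed_iInter hc)]
  intro u v hu hv hsub hdis
  obtain ⟨P, Q, hP, hQ, huP, hvQ, hPQ⟩ := normal_separation hu hv hdis
  obtain ⟨i, hi⟩ := exists_subset_nhds_of_isCompact' hd (fun i => (hc i).isCompact) hc
    (U := P ∪ Q) fun x hx => (hP.union hQ).mem_nhds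
      ((hsub hx).imp (fun h => huP h) (fun h => hvQ h))
  have hT : (⋂ i, S i) ⊆ S i := iInter_subset S i
  rcases isPreconnected_iff_subset_of_disjoint.1 (hS i).isPreconnected P Q hP hQ hi
    (by rw [hPQ.inter_eq, inter_empty]) with h | h
  · exact Or.inl fun x hx => (hsub hx).resolve_right fun hxv =>
      disjoint_left.1 hPQ (h (hT hx)) (hvQ hxv)
  · exact Or.inr fun x hx => (hsub hx).resolve_left fun hxu =>
      disjoint_left.1 hPQ (huP hxu) (h (hT hx))

variable [ConnectedSpace X]

lemma IrrBetween.isConnected_endLayer (h : IrrBetween p q) (hpq : p ≠ q) :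
    IsConnected (endLayer q) := by
  let ι := {N : Set X // IsCompact N ∧ IsConnected N ∧ q ∈ N ∧ N ≠ univ}
  have hne : Nonempty ι := ⟨⟨{q}, isCompact_singleton, isConnected_singleton, rfl,
    fun he => hpq (by simpa using (he ▸ mem_univ p : p ∈ ({q} : Set X)))⟩⟩
  have heq : endLayer q = ⋂ N : ι, closure (N : Set X)ᶜ := by
    ext x
    simp [endLayer, ι]
  rw [heq]
  refine isConnected_iInter_of_directed ?_ (fun _ => isClosed_closure) fun N =>
    h.isConnected_closure_compl N.2.1 N.2.2.1 N.2.2.2.1 N.2.2.2.2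
  rintro ⟨M, hMc, hM, hqM, hMne⟩ ⟨N, hNc, hN, hqN, hNne⟩
  exact ⟨⟨M ∪ N, hMc.union hNc, hM.union ⟨q, hqM, hqN⟩ hN, Or.inl hqM,
    h.union_ne_univ hMc hM hqM hMne hNc hN hqN hNne⟩,
    closure_mono (compl_subset_compl.2 subset_union_left),
    closure_mono (compl_subset_compl.2 subset_union_right)⟩

/-- If every subcontinuum with nonempty interior is decomposable, then the end layers of an
irreducible continuum have empty interior. -/
lemma IrrBetween.interior_endLayer (h : IrrBetween p q) (hpq : p ≠ q)
    (hlam : ∀ K : Set X, IsCompact K → IsConnected K → ¬ DecomposableSet K →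
      interior K = ∅) : interior (endLayer q) = ∅ := by
  set T := endLayer q with hT
  have hTc : IsClosed T := isClosed_endLayer q
  have hTconn : IsConnected T := h.isConnected_endLayer hpq
  have hpT : p ∈ T := h.mem_endLayer
  -- A subcontinuum of `X` containing `p` and having interior points contains the end layer.
  have subset_closure_interior : ∀ M : Set X, IsCompact M → IsConnected M → p ∈ M → (interior M).Nonempty →
      T ⊆ closure (interior M) := by
    intro M hMc hM hpM ⟨z, hz⟩
    by_cases hMu : M = univ
    · simp [hMu]
    have hqM : q ∉ M := h.symm.notMem_of_ne_univ hMc hM hpM hMu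
    intro x hx
    have := hx (closure Mᶜ) isClosed_closure.isCompact
      (h.symm.isConnected_closure_compl hMc hM hpM hMu) (subset_closure hqM) (by
        intro he
        have : z ∈ closure Mᶜ := he ▸ mem_univ z
        rw [closure_compl] at this
        exact this hz)
    rwa [closure_compl (s := M), compl_compl] at this
  by_contra hint
  have hne : (interior T).Nonempty := nonempty_iff_ne_empty.2 hint
  have hreg : T ⊆ closure (interior T) := subset_closure_interior T hTc.isCompact hTconn hpT hne
  have hdec : DecomposableSet T := by
    by_contra hd
    exact hint (hlam T hTc.isCompact hTconn hd)
  have key : ∀ M M' : Set X, IsCompact M → IsConnected M → M ⊆ T → M ≠ T →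
      IsCompact M' → M' ⊆ T → M' ≠ T → M ∪ M' = T → p ∈ M → False := by
    intro M M' hMc hM hMT hMne hMc' hMT' hMne' hU hpM
    have hMint : interior M = ∅ := by
      by_contra hi
      exact hMne (hMT.antisymm ((subset_closure_interior M hMc hM hpM (nonempty_iff_ne_empty.2 hi)).trans
        (closure_minimal interior_subset hMc.isClosed)))
    have hsub : interior T \ M' ⊆ interior M :=
      interior_maximal (fun x hx => ((hU ▸ interior_subset hx.1 : x ∈ M ∪ M')).resolve_right hx.2)
        (isOpen_interior.sdiff hMc'.isClosed)
    rw [hMint, subset_empty_iff, sdiff_eq_empty] at hsub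
    exact hMne' (hMT'.antisymm (hreg.trans (closure_minimal hsub hMc'.isClosed)))
  obtain ⟨M, M', hMc, hM, hMT, hMne, hMc', hM', hMT', hMne', hU⟩ := hdec
  rcases (hU ▸ hpT : p ∈ M ∪ M') with hp | hp
  · exact key M M' hMc hM hMT hMne hMc' hMT' hMne' hU hp
  · exact key M' M hMc' hM' hMT' hMne' hMc hMT hMne (by rwa [union_comm]) hp

lemma IrrBetween.irrBetween_of_mem_endLayer (h : IrrBetween p q) (hpq : p ≠ q)
    (hint : interior (endLayer q) = ∅) {x : X} (hx : x ∈ endLayer q) : IrrBetween x q := by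
  intro L hLc hL hxL hqL
  have hu := h (L ∪ endLayer q) (hLc.union (isClosed_endLayer q).isCompact)
    (hL.union ⟨x, hxL, hx⟩ (h.isConnected_endLayer hpq)) (Or.inr h.mem_endLayer) (Or.inl hqL)
  have hd : Dense (endLayer q)ᶜ := interior_eq_empty_iff_dense_compl.1 hint
  refine univ_subset_iff.1 (hd.closure_eq ▸ closure_minimal (fun y hy => ?_) hLc.isClosed)
  exact (hu ▸ mem_univ y : y ∈ L ∪ endLayer q).resolve_right hy

/-- A proper subcontinuum containing `q` misses the end layer. -/
lemma IrrBetween.disjoint_endLayer (h : IrrBetween p q) (hpq : p ≠ q)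
    (hint : interior (endLayer q) = ∅) {N : Set X} (hc : IsCompact N) (hN : IsConnected N)
    (hq : q ∈ N) (hne : N ≠ univ) : N ⊆ (endLayer q)ᶜ := fun _ hx hxT =>
  hne (h.irrBetween_of_mem_endLayer hpq hint hxT N hc hN hx hq)

lemma IrrBetween.endLayer_mem_NB (h : IrrBetween p q) (hpq : p ≠ q)
    (hint : interior (endLayer q) = ∅) : endLayer q ∈ NB X := by
  refine ⟨⟨p, h.mem_endLayer⟩, fun he => ?_, isClosed_endLayer q, fun x hx => ?_⟩
  · rw [he, interior_univ] at hint
    exact notMem_empty p (hint ▸ mem_univ p)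
  · refine (interior_eq_empty_iff_dense_compl.1 hint).mono fun y hy => ?_
    obtain ⟨N, hc, hN, hq, hne, hxN, hyN⟩ := h.exists_pair_mem_interior hx hy
    exact ⟨N, ⟨hc, hN, interior_subset hxN, h.disjoint_endLayer hpq hint hc hN hq hne⟩,
      interior_subset hyN⟩

/-- Any two points outside both end layers lie in a subcontinuum missing both end layers. -/
lemma IrrBetween.exists_subcontinuum_disjoint_endLayers (h : IrrBetween p q) (hpq : p ≠ q)
    (hq : interior (endLayer q) = ∅) (hp : interior (endLayer p) = ∅) {x y : X}
    (hx : x ∉ endLayer q ∪ endLayer p) (hy : y ∉ endLayer q ∪ endLayer p) :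
    ∃ H : Set X, IsCompact H ∧ IsConnected H ∧ x ∈ H ∧ y ∈ H ∧
      H ⊆ (endLayer q ∪ endLayer p)ᶜ := by
  rw [mem_union, not_or] at hx hy
  obtain ⟨N, hNc, hN, hqN, hNne, hxN, hyN⟩ := h.exists_pair_mem_interior hx.1 hy.1
  obtain ⟨M, hMc, hM, hpM, hMne, hxM, hyM⟩ := h.symm.exists_pair_mem_interior hx.2 hy.2
  have hK := h.isConnected_closure_compl hNc hN hqN hNne
  have hL := h.symm.isConnected_closure_compl hMc hM hpM hMne
  have hpK : p ∈ closure Nᶜ := subset_closure (h.notMem_of_ne_univ hNc hN hqN hNne)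
  have hqL : q ∈ closure Mᶜ := subset_closure (h.symm.notMem_of_ne_univ hMc hM hpM hMne)
  have hcompl : (closure Nᶜ ∪ closure Mᶜ)ᶜ = interior N ∩ interior M := by
    simp [closure_compl, compl_union]
  have hdis : Disjoint (closure Nᶜ) (closure Mᶜ) := by
    rw [disjoint_iff_inter_eq_empty]
    by_contra hne
    have hu := h _ (isClosed_closure.union isClosed_closure).isCompact
      (hK.union (nonempty_iff_ne_empty.2 hne) hL) (Or.inl hpK) (Or.inr hqL)
    rw [hu, compl_univ] at hcompl
    exact notMem_empty x (hcompl ▸ ⟨hxN, hxM⟩)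
  have hpre := h.isPreconnected_compl_union isClosed_closure hK.isPreconnected hpK
    isClosed_closure hL.isPreconnected hqL hdis
  rw [hcompl] at hpre
  refine ⟨closure (interior N ∩ interior M), isClosed_closure.isCompact,
    IsConnected.closure ⟨⟨x, hxN, hxM⟩, hpre⟩, subset_closure ⟨hxN, hxM⟩,
    subset_closure ⟨hyN, hyM⟩, ?_⟩
  rw [compl_union]
  exact subset_inter
    ((closure_minimal (inter_subset_left.trans interior_subset) hNc.isClosed).trans
      (h.disjoint_endLayer hpq hq hNc hN hqN hNne))
    ((closure_minimal (inter_subset_right.trans interior_subset) hMc.isClosed).trans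
      (h.symm.disjoint_endLayer hpq.symm hp hMc hM hpM hMne))

lemma IrrBetween.union_endLayer_mem_NB (h : IrrBetween p q) (hpq : p ≠ q)
    (hq : interior (endLayer q) = ∅) (hp : interior (endLayer p) = ∅) :
    endLayer q ∪ endLayer p ∈ NB X := by
  have hint : interior (endLayer q ∪ endLayer p) = ∅ := by
    rw [interior_union_isClosed_of_interior_empty (isClosed_endLayer q) hp, hq]
  refine ⟨⟨p, Or.inl h.mem_endLayer⟩, fun he => ?_,
    (isClosed_endLayer q).union (isClosed_endLayer p), fun x hx => ?_⟩
  · rw [he, interior_univ] at hint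
    exact notMem_empty p (hint ▸ mem_univ p)
  · refine (interior_eq_empty_iff_dense_compl.1 hint).mono fun y hy => ?_
    obtain ⟨H, hc, hH, hxH, hyH, hs⟩ :=
      h.exists_subcontinuum_disjoint_endLayers hpq hq hp hx hy
    exact ⟨H, ⟨hc, hH, hxH, hs⟩, hyH⟩

lemma IrrBetween.subset_of_mem_NB (h : IrrBetween p q) {C : Set X} (hC : C ∈ NB X) :
    C ⊆ endLayer q ∪ endLayer p := by
  intro c hc
  by_contra hcn
  rw [mem_union, not_or] at hcn
  obtain ⟨-, hCne, -, hNB⟩ := hC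
  obtain ⟨x, hx⟩ := (ne_univ_iff_exists_notMem C).1 hCne
  obtain ⟨N, hNc, hN, hqN, hNne, hcN⟩ := exists_mem_interior_of_notMem_endLayer hcn.1
  obtain ⟨M, hMc, hM, hpM, hMne, hcM⟩ := exists_mem_interior_of_notMem_endLayer hcn.2
  have hK := h.isConnected_closure_compl hNc hN hqN hNne
  have hL := h.symm.isConnected_closure_compl hMc hM hpM hMne
  have hpN := h.notMem_of_ne_univ hNc hN hqN hNne
  have hqM := h.symm.notMem_of_ne_univ hMc hM hpM hMne
  obtain ⟨y, hyN, H, ⟨hHc, hH, hxH, hHC⟩, hyH⟩ :=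
    (hNB x hx).inter_open_nonempty Nᶜ hNc.isClosed.isOpen_compl ⟨p, hpN⟩
  obtain ⟨z, hzM, H', ⟨hHc', hH', hxH', hHC'⟩, hzH⟩ :=
    (hNB x hx).inter_open_nonempty Mᶜ hMc.isClosed.isOpen_compl ⟨q, hqM⟩
  have hu := h ((closure Nᶜ ∪ H) ∪ (H' ∪ closure Mᶜ))
    ((isClosed_closure.isCompact.union hHc).union (hHc'.union isClosed_closure.isCompact))
    ((hK.union ⟨y, subset_closure hyN, hyH⟩ hH).union ⟨x, Or.inr hxH, Or.inl hxH'⟩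
      (hH'.union ⟨z, hzH, subset_closure hzM⟩ hL))
    (Or.inl (Or.inl (subset_closure hpN))) (Or.inr (Or.inr (subset_closure hqM)))
  rcases (hu ▸ mem_univ c : c ∈ (closure Nᶜ ∪ H) ∪ (H' ∪ closure Mᶜ)) with
    (h1 | h1) | (h1 | h1)
  · rw [closure_compl] at h1
    exact h1 hcN
  · exact hHC h1 hc
  · exact hHC' h1 hc
  · rw [closure_compl] at h1
    exact h1 hcM

lemma IrrBetween.endLayer_subset_of_mem_NB (h : IrrBetween p q) (hpq : p ≠ q)
    (hint : interior (endLayer q) = ∅) {C : Set X} (hC : C ∈ NB X) {a : X} (ha : a ∈ endLayer q)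
    (haC : a ∈ C) : endLayer q ⊆ C := by
  intro x hx
  by_contra hxC
  obtain ⟨z, hz, H, ⟨hHc, hH, hxH, hHC⟩, hzH⟩ :=
    (hC.2.2.2 x hxC).inter_open_nonempty _ (isClosed_endLayer q).isOpen_compl
      (interior_eq_empty_iff_dense_compl.1 hint).nonempty
  obtain ⟨N, hNc, hN, hqN, hNne, hzN⟩ := exists_mem_interior_of_notMem_endLayer hz
  have hu := h.irrBetween_of_mem_endLayer hpq hint hx (H ∪ N) (hHc.union hNc)
    (hH.union ⟨z, hzH, interior_subset hzN⟩ hN) (Or.inl hxH) (Or.inr hqN)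
  rcases (hu ▸ mem_univ a : a ∈ H ∪ N) with h1 | h1
  · exact hHC h1 haC
  · exact h.disjoint_endLayer hpq hint hNc hN hqN hNne h1 ha

/-- The end layer `endLayer q` does not contain `q`. -/
lemma IrrBetween.notMem_endLayer_self (h : IrrBetween p q) (hpq : p ≠ q)
    (hint : interior (endLayer q) = ∅) : q ∉ endLayer q :=
  h.disjoint_endLayer hpq hint isCompact_singleton isConnected_singleton rfl
    (fun he => hpq (by simpa using (he ▸ mem_univ p : p ∈ ({q} : Set X)))) rfl

end Irreducible

theorem stmt12 (X : Type*) [MetricSpace X] [CompactSpace X] [ConnectedSpace X] [Nonempty X]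
    (hirr : ∃ p q : X, p ≠ q ∧ IrrBetween p q)
    (hlam : ∀ K : Set X, IsCompact K → IsConnected K → ¬ DecomposableSet K →
      interior K = ∅) :
    (NB X).ncard = 3 := by
  obtain ⟨p, q, hpq, h⟩ := hirr
  have hq := h.interior_endLayer hpq hlam
  have hp := h.symm.interior_endLayer hpq.symm hlam
  have hqA := h.notMem_endLayer_self hpq hq
  have hpB := h.symm.notMem_endLayer_self hpq.symm hp
  have hpA : p ∈ endLayer q := h.mem_endLayer
  have hqB : q ∈ endLayer p := h.symm.mem_endLayer
  refine ncard_eq_three.2 ⟨endLayer q, endLayer p, endLayer q ∪ endLayer p,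
    fun he => hqA (he ▸ hqB), fun he => hqA (he ▸ Or.inr hqB), fun he => hpB (he ▸ Or.inl hpA), ?_⟩
  ext C
  simp only [mem_insert_iff, mem_singleton_iff]
  constructor
  · intro hC
    have hsub := h.subset_of_mem_NB hC
    by_cases hA : ∃ a ∈ endLayer q, a ∈ C
    · obtain ⟨a, ha, haC⟩ := hA
      have hAC := h.endLayer_subset_of_mem_NB hpq hq hC ha haC
      by_cases hB : ∃ b ∈ endLayer p, b ∈ C
      · obtain ⟨b, hb, hbC⟩ := hB
        exact Or.inr (Or.inr (hsub.antisymm (union_subset hAC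
          (h.symm.endLayer_subset_of_mem_NB hpq.symm hp hC hb hbC))))
      · exact Or.inl (Subset.antisymm
          (fun x hx => (hsub hx).resolve_right fun hxB => hB ⟨x, hxB, hx⟩) hAC)
    · have hCB : C ⊆ endLayer p :=
        fun x hx => (hsub hx).resolve_left fun hxA => hA ⟨x, hxA, hx⟩
      obtain ⟨c, hc⟩ := hC.1
      exact Or.inr (Or.inl (hCB.antisymm
        (h.symm.endLayer_subset_of_mem_NB hpq.symm hp hC (hCB hc) hc)))
  · rintro (rfl | rfl | rfl)
    · exact h.endLayer_mem_NB hpq hq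
    · exact h.symm.endLayer_mem_NB hpq.symm hp
    · exact h.union_endLayer_mem_NB hpq hq hp
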